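/- Let n ≥ 1, 0 < γ < n, let p⃗, q⃗ be n-tuples with 1 < pᵢ, qᵢ < ∞, let s⃗ be an n-tuple with 1 < sᵢ ≤ ∞, and let α, β satisfy (1/n)Σᵢ 1/sᵢ ≤ 1/α ≤ (1/n)Σᵢ 1/pᵢ and (1/n)Σᵢ 1/sᵢ ≤ 1/β ≤ (1/n)Σᵢ 1/qᵢ. If there is a constant C > 0 such that ‖I_γ f‖_{(L^{q⃗},L^{s⃗})^β} ≤ C·‖f‖_{(L^{p⃗},L^{s⃗})^α} for all f ∈ (L^{p⃗},L^{s⃗})^α(ℝⁿ), then γ = n/α − n/β. -/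

import Mathlib

open MeasureTheory ENNReal Filter Topology Set

noncomputable section

namespace MixedAmalgam

/-- `L^p` norm over `ℝ` of an `ℝ≥0∞`-valued function, with the usual
modification (`essSup`) for `p = ∞`. -/
def lpInt (p : ℝ≥0∞) (g : ℝ → ℝ≥0∞) : ℝ≥0∞ :=
  if p = ∞ then essSup g volume else (∫⁻ t, g t ^ p.toReal) ^ (1 / p.toReal)

/-- `ℓ^p` norm over `ℤ` of an `ℝ≥0∞`-valued family, with the usual
modification for `p = ∞`. -/
def lpSum (p : ℝ≥0∞) (g : ℤ → ℝ≥0∞) : ℝ≥0∞ :=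
  if p = ∞ then ⨆ k, g k else (∑' k, g k ^ p.toReal) ^ (1 / p.toReal)

/-- Iterated mixed Lebesgue norm of an `ℝ≥0∞`-valued function on `ℝⁿ`,
taking the `L^{p₁}` norm in the first variable innermost, and the `L^{pₙ}`
norm in the last variable outermost. -/
def mixedE : (n : ℕ) → (Fin n → ℝ≥0∞) → ((Fin n → ℝ) → ℝ≥0∞) → ℝ≥0∞
  | 0, _, g => g Fin.elim0
  | n + 1, p, g =>
    lpInt (p (Fin.last n)) fun t =>
      mixedE n (fun i => p i.castSucc) fun x => g (Fin.snoc x t)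

/-- Mixed-norm Lebesgue norm `‖f‖_{L^{p⃗}}` of a real-valued function on `ℝⁿ`. -/
def mixedLp (n : ℕ) (p : Fin n → ℝ≥0∞) (f : (Fin n → ℝ) → ℝ) : ℝ≥0∞ :=
  mixedE n p fun x => (‖f x‖₊ : ℝ≥0∞)

/-- Iterated mixed `ℓ^{s⃗}` norm of an `ℝ≥0∞`-valued family indexed by `ℤⁿ`. -/
def mixedSeq : (n : ℕ) → (Fin n → ℝ≥0∞) → ((Fin n → ℤ) → ℝ≥0∞) → ℝ≥0∞
  | 0, _, a => a Fin.elim0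
  | n + 1, s, a =>
    lpSum (s (Fin.last n)) fun k =>
      mixedSeq n (fun i => s i.castSucc) fun m => a (Fin.snoc m k)

/-- Open Euclidean ball of center `y` and radius `r` in `ℝⁿ`. -/
def eball (n : ℕ) (y : Fin n → ℝ) (r : ℝ) : Set (Fin n → ℝ) :=
  {x | Real.sqrt (∑ i, (x i - y i) ^ 2) < r}

/-- `Σᵢ 1/pᵢ` as a real number. -/
def invSum (n : ℕ) (p : Fin n → ℝ≥0∞) : ℝ :=
  ∑ i, (1 / p i).toReal

/-- The `(L^{p⃗},L^{s⃗})` amalgam norm computed with balls of radius `r`. -/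
def amalgamNormR (n : ℕ) (p s : Fin n → ℝ≥0∞) (r : ℝ) (f : (Fin n → ℝ) → ℝ) : ℝ≥0∞ :=
  mixedE n s fun y => mixedLp n p ((eball n y r).indicator f)

/-- The amalgam norm `‖f‖_{(L^{p⃗},L^{s⃗})}`. -/
def amalgamNorm (n : ℕ) (p s : Fin n → ℝ≥0∞) (f : (Fin n → ℝ) → ℝ) : ℝ≥0∞ :=
  amalgamNormR n p s 1 f

/-- The amalgam norm `‖f‖_{(L^{p⃗},L^{s⃗})^α}`. -/
def amalgamNormA (n : ℕ) (p s : Fin n → ℝ≥0∞) (α : ℝ≥0∞) (f : (Fin n → ℝ) → ℝ) : ℝ≥0∞ :=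
  ⨆ (r : ℝ) (_ : 0 < r),
    mixedE n s fun y =>
      volume (eball n y r) ^
          ((1 / α).toReal - invSum n p / (n : ℝ) - invSum n s / (n : ℝ)) *
        mixedLp n p ((eball n y r).indicator f)

/-- The amalgam norm `‖·‖_{(L^{p⃗},L^{s⃗})^α}` for `ℝ≥0∞`-valued functions. -/
def amalgamNormAE (n : ℕ) (p s : Fin n → ℝ≥0∞) (α : ℝ≥0∞)
    (g : (Fin n → ℝ) → ℝ≥0∞) : ℝ≥0∞ :=
  ⨆ (r : ℝ) (_ : 0 < r),
    mixedE n s fun y =>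
      volume (eball n y r) ^
          ((1 / α).toReal - invSum n p / (n : ℝ) - invSum n s / (n : ℝ)) *
        mixedE n p ((eball n y r).indicator g)

/-- The cube `Q_{r,k} = r(k + [0,1)ⁿ)`. -/
def qcube (n : ℕ) (r : ℝ) (k : Fin n → ℤ) : Set (Fin n → ℝ) :=
  {x | ∀ i, r * (k i : ℝ) ≤ x i ∧ x i < r * ((k i : ℝ) + 1)}

/-- The discrete amalgam norm `_r‖f‖_{p⃗,s⃗}`. -/
def discNormR (n : ℕ) (p s : Fin n → ℝ≥0∞) (r : ℝ) (f : (Fin n → ℝ) → ℝ) : ℝ≥0∞ :=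
  mixedSeq n s fun k => mixedLp n p ((qcube n r k).indicator f)

/-- The discrete amalgam norm `‖f‖_{p⃗,s⃗} = _1‖f‖_{p⃗,s⃗}`. -/
def discNorm (n : ℕ) (p s : Fin n → ℝ≥0∞) (f : (Fin n → ℝ) → ℝ) : ℝ≥0∞ :=
  discNormR n p s 1 f

/-- The discrete amalgam norm
`‖f‖_{p⃗,s⃗,α} = sup_{r>0} r^{n/α - Σᵢ 1/pᵢ} · _r‖f‖_{p⃗,s⃗}`. -/
def discNormA (n : ℕ) (p s : Fin n → ℝ≥0∞) (α : ℝ≥0∞) (f : (Fin n → ℝ) → ℝ) : ℝ≥0∞ :=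
  ⨆ (r : ℝ) (_ : 0 < r),
    ENNReal.ofReal (r ^ ((n : ℝ) * (1 / α).toReal - invSum n p)) * discNormR n p s r f

/-- Membership in `(L^{p⃗},L^{s⃗})^α(ℝⁿ)` (continuous form). -/
def memA (n : ℕ) (p s : Fin n → ℝ≥0∞) (α : ℝ≥0∞) (f : (Fin n → ℝ) → ℝ) : Prop :=
  LocallyIntegrable f volume ∧ amalgamNormA n p s α f < ∞

/-- Membership in `(L^{p⃗},ℓ^{s⃗})(ℝⁿ)`. -/
def memD (n : ℕ) (p s : Fin n → ℝ≥0∞) (f : (Fin n → ℝ) → ℝ) : Prop :=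
  LocallyIntegrable f volume ∧ discNorm n p s f < ∞

/-- Membership in `(L^{p⃗},ℓ^{s⃗})^α(ℝⁿ)`. -/
def memDA (n : ℕ) (p s : Fin n → ℝ≥0∞) (α : ℝ≥0∞) (f : (Fin n → ℝ) → ℝ) : Prop :=
  LocallyIntegrable f volume ∧ discNormA n p s α f < ∞

/-- The dilation `St_r^{(α)} f = r^{-n/α} f(r⁻¹ ·)`. -/
def dil (n : ℕ) (α : ℝ≥0∞) (r : ℝ) (f : (Fin n → ℝ) → ℝ) : (Fin n → ℝ) → ℝ :=
  fun x => r ^ (-((n : ℝ) * (1 / α).toReal)) * f (r⁻¹ • x)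

/-- A block decomposition `f = Σ_j c_j St_{r_j}^{(α')} f_j` converging in `L¹_loc`. -/
structure BlockDecomp (n : ℕ) (p' s' : Fin n → ℝ≥0∞) (α' : ℝ≥0∞) (f : (Fin n → ℝ) → ℝ)
    (c : ℕ → ℝ) (rr : ℕ → ℝ) (g : ℕ → (Fin n → ℝ) → ℝ) : Prop where
  csummable : Summable fun j => |c j|
  rpos : ∀ j, 0 < rr j
  gloc : ∀ j, LocallyIntegrable (g j) volume
  gnorm : ∀ j, discNorm n p' s' (g j) ≤ 1
  conv : ∀ K : Set (Fin n → ℝ), IsCompact K →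
    Tendsto (fun J : ℕ =>
        ∫⁻ x in K,
          (‖f x - ∑ j ∈ Finset.range J, c j * dil n α' (rr j) (g j) x‖₊ : ℝ≥0∞))
      atTop (𝓝 0)

/-- Membership in the block space `H(p⃗',s⃗',α')`. -/
def memH (n : ℕ) (p' s' : Fin n → ℝ≥0∞) (α' : ℝ≥0∞) (f : (Fin n → ℝ) → ℝ) : Prop :=
  LocallyIntegrable f volume ∧ ∃ c rr g, BlockDecomp n p' s' α' f c rr g

/-- The norm of the block space `H(p⃗',s⃗',α')`. -/
def hNorm (n : ℕ) (p' s' : Fin n → ℝ≥0∞) (α' : ℝ≥0∞) (f : (Fin n → ℝ) → ℝ) : ℝ≥0∞ :=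
  ⨅ (c : ℕ → ℝ) (rr : ℕ → ℝ) (g : ℕ → (Fin n → ℝ) → ℝ)
    (_ : BlockDecomp n p' s' α' f c rr g), ENNReal.ofReal (∑' j, |c j|)

/-- The fractional integral operator `I_γ`. -/
def fracInt (n : ℕ) (γ : ℝ) (f : (Fin n → ℝ) → ℝ) : (Fin n → ℝ) → ℝ :=
  fun x => ∫ y, f y / Real.sqrt (∑ i, (x i - y i) ^ 2) ^ ((n : ℝ) - γ)

/-- The fractional maximal operator `M_γ`. -/
def fracMax (n : ℕ) (γ : ℝ) (f : (Fin n → ℝ) → ℝ) : (Fin n → ℝ) → ℝ≥0∞ :=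
  fun x => ⨆ (y : Fin n → ℝ) (r : ℝ) (_ : 0 < r) (_ : x ∈ eball n y r),
    volume (eball n y r) ^ (γ / (n : ℝ) - 1) * ∫⁻ z in eball n y r, (‖f z‖₊ : ℝ≥0∞)

/-- The commutator `[b, I_γ] f`. -/
def commFracInt (n : ℕ) (γ : ℝ) (b f : (Fin n → ℝ) → ℝ) : (Fin n → ℝ) → ℝ :=
  fun x => ∫ y, (b x - b y) * f y / Real.sqrt (∑ i, (x i - y i) ^ 2) ^ ((n : ℝ) - γ)

/-- The mean value `b_B` of `b` over the ball `B(y,r)`. -/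
def ballAvg (n : ℕ) (b : (Fin n → ℝ) → ℝ) (y : Fin n → ℝ) (r : ℝ) : ℝ :=
  (volume (eball n y r)).toReal⁻¹ * ∫ x in eball n y r, b x

/-- The `BMO` norm `sup_B (1/|B|) ∫_B |b - b_B|`. -/
def bmoNorm (n : ℕ) (b : (Fin n → ℝ) → ℝ) : ℝ≥0∞ :=
  ⨆ (y : Fin n → ℝ) (r : ℝ) (_ : 0 < r),
    ENNReal.ofReal
      ((volume (eball n y r)).toReal⁻¹ * ∫ x in eball n y r, |b x - ballAvg n b y r|)

open Classical in
def cubeF (n : ℕ) (a : Fin n → ℝ) (L : ℝ) (c : ℝ≥0∞) (x : Fin n → ℝ) : ℝ≥0∞ :=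
  if ∀ i, a i ≤ x i ∧ x i ≤ a i + L then c else 0

theorem lpInt_mono (p : ℝ≥0∞) {g h : ℝ → ℝ≥0∞} (H : ∀ t, g t ≤ h t) :
    lpInt p g ≤ lpInt p h := by
  unfold lpInt
  split_ifs
  · exact essSup_mono_ae (Eventually.of_forall H)
  · gcongr with t
    exact H t

theorem mixedE_mono (n : ℕ) (p : Fin n → ℝ≥0∞) {g h : (Fin n → ℝ) → ℝ≥0∞}
    (H : ∀ t, g t ≤ h t) : mixedE n p g ≤ mixedE n p h := by
  induction n with
  | zero => exact H _
  | succ n ih => exact lpInt_mono _ fun t => ih _ fun x => H _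

open Classical in
theorem lpInt_ind (p : ℝ≥0∞) (hp : p ≠ 0) (a L : ℝ) (hL : 0 < L) (c : ℝ≥0∞) :
    lpInt p (fun t => if a ≤ t ∧ t ≤ a + L then c else 0)
      = c * ENNReal.ofReal L ^ (1 / p).toReal := by
  have hv : volume (Icc a (a + L)) = ENNReal.ofReal L := by simp
  unfold lpInt
  split_ifs with h
  · subst h
    have e : (fun t => if a ≤ t ∧ t ≤ a + L then c else 0)
      = (Icc a (a + L)).indicator (fun _ => c) := by
      ext t; simp [Set.indicator, Set.mem_Icc]
    rw [e, essSup_indicator_eq_essSup_restrict measurableSet_Icc, essSup_const]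
    · simp
    · simp [hL]
  · have hpp : 0 < p.toReal := ENNReal.toReal_pos hp h
    have e : (fun t => (if a ≤ t ∧ t ≤ a + L then c else 0) ^ p.toReal)
      = (Icc a (a + L)).indicator (fun _ => c ^ p.toReal) := by
      ext t
      by_cases ht : a ≤ t ∧ t ≤ a + L
      · simp [Set.indicator, Set.mem_Icc, ht]
      · simp [Set.indicator, Set.mem_Icc, ht, hpp]
    rw [e, lintegral_indicator_const measurableSet_Icc, hv,
      ENNReal.mul_rpow_of_nonneg _ _ (by positivity), ← ENNReal.rpow_mul]
    rw [mul_one_div_cancel hpp.ne', ENNReal.rpow_one]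
    simp [ENNReal.toReal_inv]

theorem mixedE_cube (n : ℕ) (p : Fin n → ℝ≥0∞) (hp : ∀ i, p i ≠ 0) (a : Fin n → ℝ) (L : ℝ)
    (hL : 0 < L) (c : ℝ≥0∞) :
    mixedE n p (cubeF n a L c) = c * ENNReal.ofReal L ^ (invSum n p) := by
  classical
  induction n generalizing c with
  | zero => simp [mixedE, cubeF, invSum]
  | succ n ih =>
    have hL0 : ENNReal.ofReal L ≠ 0 := by simpa using hL
    have e : ∀ t : ℝ, (fun x : Fin n → ℝ => cubeF (n+1) a L c (Fin.snoc x t)) =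
        cubeF n (fun i => a i.castSucc) L
          (if a (Fin.last n) ≤ t ∧ t ≤ a (Fin.last n) + L then c else 0) := by
      intro t
      ext x
      simp only [cubeF, Fin.forall_fin_succ', Fin.snoc_castSucc, Fin.snoc_last, ite_and]
    rw [mixedE]
    simp only [e]
    simp only [ih _ (fun i => hp i.castSucc), ite_mul, zero_mul]
    rw [lpInt_ind _ (hp _) _ _ hL, mul_assoc, ← ENNReal.rpow_add _ _ hL0 ENNReal.ofReal_ne_top]
    simp [invSum, Fin.sum_univ_castSucc]

theorem eball_sub (n : ℕ) (y : Fin n → ℝ) (r : ℝ) {x : Fin n → ℝ} (hx : x ∈ eball n y r) (i) :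
    |x i - y i| < r := by
  refine lt_of_le_of_lt ?_ hx
  apply Real.abs_le_sqrt
  exact Finset.single_le_sum (f := fun i => (x i - y i)^2) (fun _ _ => sq_nonneg _) (Finset.mem_univ i)

theorem sqrt_le (n : ℕ) (x y : Fin n → ℝ) (d : ℝ) (hd : ∀ i, |x i - y i| ≤ d) (hd0 : 0 ≤ d) :
    Real.sqrt (∑ i, (x i - y i) ^ 2) ≤ n * d := by
  apply Real.sqrt_le_iff.2 ⟨by positivity, ?_⟩
  have h1 : ∑ i, (x i - y i) ^ 2 ≤ ∑ i : Fin n, d ^ 2 :=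
    Finset.sum_le_sum fun i _ => sq_le_sq' (by linarith [abs_le.1 (hd i)]) (abs_le.1 (hd i)).2
  simp at h1
  have h2 : (n : ℝ) ≤ (n:ℝ)^2 := by
    rcases Nat.eq_zero_or_pos n with h | h
    · simp [h]
    · have : (1:ℝ) ≤ n := by exact_mod_cast h
      nlinarith
  nlinarith [sq_nonneg d]

theorem vol_upper (n : ℕ) (y : Fin n → ℝ) (r : ℝ) (hr : 0 < r) :
    volume (eball n y r) ≤ ENNReal.ofReal (2 * r) ^ (n : ℝ) := by
  have : eball n y r ⊆ Icc (fun i => y i - r) (fun i => y i + r) := by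
    intro x hx
    refine ⟨fun i => ?_, fun i => ?_⟩ <;> have := abs_lt.1 (eball_sub n y r hx i) <;> simp <;> linarith
  refine (measure_mono this).trans ?_
  rw [Real.volume_Icc_pi]
  simp [show ∀ i, y i + r - (y i - r) = 2 * r by intro i; ring]

theorem vol_lower (n : ℕ) (hn : 1 ≤ n) (y : Fin n → ℝ) (r : ℝ) (hr : 0 < r) :
    ENNReal.ofReal (r / n) ^ (n : ℝ) ≤ volume (eball n y r) := by
  have hn0 : (0:ℝ) < n := by exact_mod_cast hn
  have : Icc (fun i => y i - r / n / 2) (fun i => y i + r / n / 2) ⊆ eball n y r := by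
    intro x hx
    have := sqrt_le n x y (r / n / 2) (fun i => abs_le.2 ⟨by linarith [hx.1 i], by linarith [hx.2 i]⟩)
      (by positivity)
    refine lt_of_le_of_lt this ?_
    field_simp
    linarith
  refine le_trans (le_of_eq ?_) (measure_mono this)
  rw [Real.volume_Icc_pi]
  simp [show ∀ i, y i + r / n / 2 - (y i - r / n / 2) = r / n by intro i; ring]

theorem rpow_anti {x y : ℝ≥0∞} (h : x ≤ y) {e : ℝ} (he : e ≤ 0) : y ^ e ≤ x ^ e := by
  have h1 := ENNReal.rpow_le_rpow h (show 0 ≤ -e by linarith)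
  rw [ENNReal.rpow_neg, ENNReal.rpow_neg] at h1
  exact ENNReal.inv_le_inv.1 h1

def testF (n : ℕ) (t : ℝ) : (Fin n → ℝ) → ℝ :=
  (Icc (fun _ => (0:ℝ)) (fun _ => t)).indicator (fun _ => 1)

theorem invSum_nonneg (n : ℕ) (p : Fin n → ℝ≥0∞) : 0 ≤ invSum n p :=
  Finset.sum_nonneg fun _ _ => ENNReal.toReal_nonneg

theorem inner_upper (n : ℕ) (p : Fin n → ℝ≥0∞) (hp : ∀ i, p i ≠ 0) (t r : ℝ) (ht : 0 < t)
    (hr : 0 < r) (y : Fin n → ℝ) :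
    mixedLp n p ((eball n y r).indicator (testF n t)) ≤
      cubeF n (fun _ => - r) (t + 2 * r) (ENNReal.ofReal (min (2 * r) t) ^ invSum n p) y := by
  classical
  have key : ∀ x, (‖(eball n y r).indicator (testF n t) x‖₊ : ℝ≥0∞) ≠ 0 →
      (x ∈ eball n y r ∧ x ∈ Icc (fun _ => (0:ℝ)) (fun _ => t)) := by
    intro x hx
    by_contra hc
    apply hx
    by_cases h1 : x ∈ eball n y r
    · have h2 : x ∉ Icc (fun _ => (0:ℝ)) (fun _ => t) := fun h => hc ⟨h1, h⟩
      simp [testF, h1, h2]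
    · simp [h1]
  have one : ∀ x, (‖(eball n y r).indicator (testF n t) x‖₊ : ℝ≥0∞) ≤ 1 := by
    intro x
    simp only [testF, Set.indicator]
    split_ifs <;> simp
  have bd : ∀ (a : Fin n → ℝ) (L : ℝ) (c : ℝ≥0∞), 0 < L →
      (∀ x, x ∈ eball n y r → x ∈ Icc (fun _ => (0:ℝ)) (fun _ => t) →
        (∀ i, a i ≤ x i ∧ x i ≤ a i + L) ∧ 1 ≤ c) →
      mixedLp n p ((eball n y r).indicator (testF n t)) ≤ c * ENNReal.ofReal L ^ invSum n p := by
    intro a L c hL h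
    rw [← mixedE_cube n p hp a L hL c]
    apply mixedE_mono
    intro x
    by_cases hx : (‖(eball n y r).indicator (testF n t) x‖₊ : ℝ≥0∞) = 0
    · rw [hx]; exact zero_le
    · obtain ⟨h1, h2⟩ := key x hx
      obtain ⟨h3, h4⟩ := h x h1 h2
      rw [cubeF, if_pos h3]
      exact (one x).trans h4
  rw [cubeF]
  split_ifs with hy
  · rcases min_choice (2 * r) t with h | h
    · rw [h, ← one_mul (_ ^ _)]
      apply bd (fun i => y i - r) _ _ (by linarith)
      intro x hx _
      refine ⟨fun i => ?_, le_rfl⟩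
      have := abs_lt.1 (eball_sub n y r hx i)
      constructor <;> linarith
    · rw [h, ← one_mul (_ ^ _)]
      apply bd (fun i => 0) _ _ ht
      intro x _ hx
      exact ⟨fun i => ⟨hx.1 i, by simpa using hx.2 i⟩, le_rfl⟩
  · have := bd (fun i => 0) 1 0 one_pos (by
      intro x hx hx2
      exfalso
      apply hy
      intro i
      have := abs_lt.1 (eball_sub n y r hx i)
      have h1 := hx2.1 i
      have h2 := hx2.2 i
      simp only at h1 h2
      constructor <;> linarith)
    simpa using this

theorem upper (n : ℕ) (hn : 1 ≤ n) (p s : Fin n → ℝ≥0∞) (α : ℝ≥0∞)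
    (hp : ∀ i, p i ≠ 0) (hs : ∀ i, s i ≠ 0)
    (hα1 : invSum n s / (n : ℝ) ≤ (1 / α).toReal)
    (hα2 : (1 / α).toReal ≤ invSum n p / (n : ℝ)) :
    ∃ K : ℝ, 0 < K ∧ ∀ t : ℝ, 0 < t →
      amalgamNormA n p s α (testF n t) ≤ ENNReal.ofReal (K * t ^ (n * (1 / α).toReal)) := by
  have hn0 : (0:ℝ) < n := by exact_mod_cast hn
  have hP := invSum_nonneg n p
  have hS := invSum_nonneg n s
  set A := (1 / α).toReal
  set P := invSum n p with hPd
  set S := invSum n s with hSd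
  have h1 : S ≤ n * A := by rw [div_le_iff₀ hn0] at hα1; linarith
  have h2 : n * A ≤ P := by rw [le_div_iff₀ hn0] at hα2; linarith
  set E := n * A - P - S with hE
  have he : A - P / n - S / n ≤ 0 := by
    have : 0 ≤ S / n := by positivity
    linarith
  have hne : n * (A - P / n - S / n) = E := by field_simp; exact hE.symm
  refine ⟨(1 / (2 * n)) ^ E * 2 ^ S, by positivity, fun t ht => ?_⟩
  refine iSup₂_le fun r hr => ?_
  have hc := mixedE_cube n s hs (fun _ => -r) (t + 2 * r) (by linarith)
    (ENNReal.ofReal (r / n) ^ E * ENNReal.ofReal (min (2 * r) t) ^ P)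
  have : mixedE n s (fun y => volume (eball n y r) ^ (A - P / n - S / n) *
        mixedLp n p ((eball n y r).indicator (testF n t))) ≤
      (ENNReal.ofReal (r / n) ^ E * ENNReal.ofReal (min (2 * r) t) ^ P)
        * ENNReal.ofReal (t + 2 * r) ^ S := by
    rw [← hc]
    apply mixedE_mono
    intro y
    have a1 : volume (eball n y r) ^ (A - P / n - S / n) ≤ ENNReal.ofReal (r / n) ^ E := by
      rw [← hne, ENNReal.rpow_mul]
      exact rpow_anti (vol_lower n hn y r hr) he
    have a2 := inner_upper n p hp t r ht hr y
    refine (mul_le_mul' a1 a2).trans (le_of_eq ?_)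
    simp only [cubeF]
    split_ifs <;> simp [hPd]
  refine this.trans ?_
  have hm : 0 < min (2 * r) t := lt_min (by linarith) ht
  rw [ENNReal.ofReal_rpow_of_pos (by positivity), ENNReal.ofReal_rpow_of_pos hm,
    ENNReal.ofReal_rpow_of_pos (by positivity), ← ENNReal.ofReal_mul (by positivity),
    ← ENNReal.ofReal_mul (by positivity)]
  apply ENNReal.ofReal_le_ofReal
  obtain ⟨u, hu⟩ : ∃ u, u = 2 * r := ⟨_, rfl⟩
  have hu0 : 0 < u := by linarith
  rw [← hu] at hm ⊢
  have : r / n = 1 / (2 * n) * u := by rw [hu]; field_simp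
  rw [this, Real.mul_rpow (by positivity) hu0.le]
  suffices h : u ^ E * min u t ^ P * (t + u) ^ S ≤ 2 ^ S * t ^ (n * A) by
    calc _ = (1 / (2 * n : ℝ)) ^ E * (u ^ E * min u t ^ P * (t + u) ^ S) := by ring
      _ ≤ (1 / (2 * n : ℝ)) ^ E * (2 ^ S * t ^ (n * A)) := by gcongr
      _ = _ := by ring
  rcases le_total u t with h | h
  · rw [min_eq_left h, ← Real.rpow_add hu0]
    calc u ^ (E + P) * (t + u) ^ S ≤ t ^ (E + P) * (2 * t) ^ S := by
          apply mul_le_mul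
          · exact Real.rpow_le_rpow hu0.le h (by linarith)
          · exact Real.rpow_le_rpow (by positivity) (by linarith) hS
          · positivity
          · positivity
      _ = 2 ^ S * (t ^ (E + P) * t ^ S) := by rw [Real.mul_rpow (by norm_num) ht.le]; ring
      _ = _ := by rw [← Real.rpow_add ht]; congr 2; rw [hE]; ring
  · rw [min_eq_right h]
    calc u ^ E * t ^ P * (t + u) ^ S ≤ u ^ E * t ^ P * (2 * u) ^ S := by
          gcongr; linarith
      _ = 2 ^ S * (u ^ (E + S) * t ^ P) := by
          rw [Real.mul_rpow (by norm_num) hu0.le, Real.rpow_add hu0]; ring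
      _ ≤ 2 ^ S * (t ^ (E + S) * t ^ P) := by
          gcongr 2 ^ S * (?_ * _)
          exact Real.rpow_le_rpow_of_nonpos ht h (by linarith)
      _ = _ := by rw [← Real.rpow_add ht]; congr 2; rw [hE]; ring

theorem frac_lower (n : ℕ) (hn : 1 ≤ n) (γ : ℝ) (hγn : γ < n) (t : ℝ) (ht : 0 < t)
    (x : Fin n → ℝ) (hx : ∀ i, 2 * t ≤ x i ∧ x i ≤ 2 * t + t) :
    (3 * n : ℝ) ^ (γ - n) * t ^ γ ≤ fracInt n γ (testF n t) x := by
  have hn0 : (0:ℝ) < n := by exact_mod_cast hn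
  set Q := Icc (fun _ : Fin n => (0:ℝ)) (fun _ => t)
  have e : fracInt n γ (testF n t) x =
      ∫ y in Q, 1 / Real.sqrt (∑ i, (x i - y i) ^ 2) ^ ((n : ℝ) - γ) := by
    rw [← integral_indicator measurableSet_Icc]
    unfold fracInt testF
    congr 1
    ext y
    by_cases hy : y ∈ Q
    · rw [Set.indicator_of_mem hy, Set.indicator_of_mem hy]
    · rw [Set.indicator_of_notMem hy, Set.indicator_of_notMem hy, zero_div]
  have pos : ∀ y ∈ Q, 0 < Real.sqrt (∑ i, (x i - y i) ^ 2) := by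
    intro y hy
    apply Real.sqrt_pos.2
    apply Finset.sum_pos
    · intro i _
      have h1 := hy.2 i
      have := hx i
      simp only at h1
      have : 0 < x i - y i := by linarith
      positivity
    · exact ⟨⟨0, hn⟩, Finset.mem_univ _⟩
  have hint : IntegrableOn (fun y => 1 / Real.sqrt (∑ i, (x i - y i) ^ 2) ^ ((n : ℝ) - γ)) Q := by
    apply ContinuousOn.integrableOn_compact isCompact_Icc
    apply ContinuousOn.div continuousOn_const
    · apply ContinuousOn.rpow_const
      · fun_prop
      · intro y hy; exact Or.inl (pos y hy).ne'
    · intro y hy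
      exact (Real.rpow_pos_of_pos (pos y hy) _).ne'
  have hvol : volume.real Q = t ^ n := by
    rw [Measure.real, Real.volume_Icc_pi_toReal]
    · simp
    · intro i; exact ht.le
  rw [e]
  calc (3 * n : ℝ) ^ (γ - n) * t ^ γ = ∫ y in Q, (3 * n * t : ℝ) ^ (γ - n) := by
        rw [setIntegral_const, hvol, Real.mul_rpow (by positivity) ht.le, smul_eq_mul,
          Real.rpow_sub ht, Real.rpow_natCast]
        field_simp
    _ ≤ _ := by
      apply setIntegral_mono_on
      · exact integrableOn_const (isCompact_Icc.measure_lt_top.ne)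
      · exact hint
      · exact measurableSet_Icc
      · intro y hy
        rw [one_div, ← Real.rpow_neg (Real.sqrt_nonneg _), neg_sub]
        apply Real.rpow_le_rpow_of_nonpos (pos y hy) _ (by linarith)
        have := sqrt_le n x y (3 * t) (fun i => by
          have h1 := hy.1 i
          have h2 := hy.2 i
          have := hx i
          simp only at h1 h2
          exact abs_le.2 ⟨by linarith, by linarith⟩) (by positivity)
        linarith

theorem lower (n : ℕ) (hn : 1 ≤ n) (γ : ℝ) (hγn : γ < n) (q s : Fin n → ℝ≥0∞) (β : ℝ≥0∞)
    (hq : ∀ i, q i ≠ 0) (hs : ∀ i, s i ≠ 0)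
    (hβ2 : (1 / β).toReal ≤ invSum n q / (n : ℝ)) :
    ∃ K : ℝ, 0 < K ∧ ∀ t : ℝ, 0 < t →
      ENNReal.ofReal (K * t ^ (γ + n * (1 / β).toReal)) ≤
        amalgamNormA n q s β (fracInt n γ (testF n t)) := by
  have hn0 : (0:ℝ) < n := by exact_mod_cast hn
  have hS := invSum_nonneg n s
  set A := (1 / β).toReal
  set P := invSum n q with hPd
  set S := invSum n s with hSd
  set E := n * A - P - S with hE
  have he : A - P / n - S / n ≤ 0 := by
    have : 0 ≤ S / n := by positivity
    linarith
  have hne : n * (A - P / n - S / n) = E := by field_simp; exact hE.symm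
  refine ⟨(4 * n) ^ E * (3 * n) ^ (γ - n), by positivity, fun t ht => ?_⟩
  have hr : 0 < 2 * n * t := by positivity
  refine le_trans ?_ (le_iSup₂_of_le (2 * n * t) hr le_rfl)
  set c0 := (3 * n : ℝ) ^ (γ - n) * t ^ γ with hc0
  have hc0p : 0 < c0 := by positivity
  have hc := mixedE_cube n s hs (fun _ => 2 * t) t ht
    (ENNReal.ofReal (2 * (2 * n * t)) ^ E * (ENNReal.ofReal c0 * ENNReal.ofReal t ^ P))
  have : ENNReal.ofReal (2 * (2 * n * t)) ^ E * (ENNReal.ofReal c0 * ENNReal.ofReal t ^ P)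
        * ENNReal.ofReal t ^ S ≤
      mixedE n s (fun y => volume (eball n y (2 * n * t)) ^ (A - P / n - S / n) *
        mixedLp n q ((eball n y (2 * n * t)).indicator (fracInt n γ (testF n t)))) := by
    rw [← hc]
    apply mixedE_mono
    intro y
    rw [cubeF]
    split_ifs with hy
    · apply mul_le_mul'
      · rw [← hne, ENNReal.rpow_mul]
        exact rpow_anti (vol_upper n y _ hr) he
      · rw [← mixedE_cube n q hq (fun _ => 2 * t) t ht]
        apply mixedE_mono
        intro x
        rw [cubeF]
        split_ifs with hx
        · have hxy : x ∈ eball n y (2 * n * t) := by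
            have := sqrt_le n x y t (fun i => abs_le.2
              ⟨by linarith [hx i, hy i], by linarith [hx i, hy i]⟩) ht.le
            refine lt_of_le_of_lt this ?_
            nlinarith
          rw [Set.indicator_of_mem hxy]
          have h := frac_lower n hn γ hγn t ht x hx
          rw [← enorm_eq_nnnorm, Real.enorm_eq_ofReal (hc0p.le.trans h)]
          exact ENNReal.ofReal_le_ofReal h
        · exact zero_le
    · exact zero_le
  refine le_trans (le_of_eq ?_) this
  rw [ENNReal.ofReal_rpow_of_pos (by positivity), ENNReal.ofReal_rpow_of_pos ht,
    ENNReal.ofReal_rpow_of_pos ht, ← ENNReal.ofReal_mul (by positivity),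
    ← ENNReal.ofReal_mul (by positivity), ← ENNReal.ofReal_mul (by positivity)]
  congr 1
  rw [show 2 * (2 * n * t) = 4 * n * t by ring, Real.mul_rpow (by positivity) ht.le, hc0,
    show γ + n * A = E + γ + P + S by rw [hE]; ring, Real.rpow_add ht, Real.rpow_add ht,
    Real.rpow_add ht]
  ring

/-- Necessity of the scaling condition: if `I_γ` is bounded
from `(L^{p⃗},L^{s⃗})^α(ℝⁿ)` to `(L^{q⃗},L^{s⃗})^β(ℝⁿ)`, then `γ = n/α - n/β`. -/
theorem statement14 (n : ℕ) (hn : 1 ≤ n) (γ : ℝ) (hγ0 : 0 < γ) (hγn : γ < n)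
    (p q s : Fin n → ℝ≥0∞) (α β : ℝ≥0∞)
    (hp : ∀ i, 1 < p i ∧ p i < ∞) (hq : ∀ i, 1 < q i ∧ q i < ∞) (hs : ∀ i, 1 < s i)
    (hα1 : invSum n s / (n : ℝ) ≤ (1 / α).toReal)
    (hα2 : (1 / α).toReal ≤ invSum n p / (n : ℝ))
    (hβ1 : invSum n s / (n : ℝ) ≤ (1 / β).toReal)
    (hβ2 : (1 / β).toReal ≤ invSum n q / (n : ℝ))
    (hbound : ∃ C : ℝ≥0∞, 0 < C ∧ C < ∞ ∧
      ∀ f : (Fin n → ℝ) → ℝ, memA n p s α f →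
        amalgamNormA n q s β (fracInt n γ f) ≤ C * amalgamNormA n p s α f) :
    γ = (n : ℝ) * (1 / α).toReal - (n : ℝ) * (1 / β).toReal := by
  have hp0 : ∀ i, p i ≠ 0 := fun i => (zero_lt_one.trans (hp i).1).ne'
  have hq0 : ∀ i, q i ≠ 0 := fun i => (zero_lt_one.trans (hq i).1).ne'
  have hs0 : ∀ i, s i ≠ 0 := fun i => (zero_lt_one.trans (hs i)).ne'
  obtain ⟨C, hC0, hC, hb⟩ := hbound
  obtain ⟨K, hK, hKt⟩ := upper n hn p s α hp0 hs0 hα1 hα2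
  obtain ⟨k, hk, hkt⟩ := lower n hn γ hγn q s β hq0 hs0 hβ2
  have main : ∀ t : ℝ, 0 < t →
      t ^ (γ + n * (1 / β).toReal - n * (1 / α).toReal) ≤ C.toReal * K / k := by
    intro t ht
    have hmem : memA n p s α (testF n t) := by
      refine ⟨?_, (hKt t ht).trans_lt ENNReal.ofReal_lt_top⟩
      apply Integrable.locallyIntegrable
      apply (integrable_indicator_iff measurableSet_Icc).2
      exact integrableOn_const (isCompact_Icc.measure_lt_top.ne)
    have h := (hkt t ht).trans ((hb _ hmem).trans (mul_le_mul_right (hKt t ht) C))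
    rw [← ENNReal.ofReal_toReal hC.ne, ← ENNReal.ofReal_mul ENNReal.toReal_nonneg,
      ENNReal.ofReal_le_ofReal_iff (by positivity)] at h
    rw [Real.rpow_sub ht, div_le_div_iff₀ (by positivity) hk]
    linarith
  by_contra hne
  set d := γ + n * (1 / β).toReal - n * (1 / α).toReal with hd
  have hd0 : d ≠ 0 := by
    intro h
    apply hne
    linarith
  have hM : 0 ≤ C.toReal * K / k := by positivity
  have := main ((C.toReal * K / k + 1) ^ (1 / d)) (by positivity)
  rw [← Real.rpow_mul (by positivity), one_div_mul_cancel hd0, Real.rpow_one] at this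
  linarith

end MixedAmalgam

end
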